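/- Suppose H_1 ∈ 𝒜 is generic, i.e. for every Y ∈ L(𝒜 ∖ {H_1}) that is not a maximal element of L(𝒜 ∖ {H_1}), H_1 intersects Y transversely: H_1 ∩ Y ≠ ∅ and codim(H_1 ∩ Y) = codim(Y) + 1. Then for each maximal X ∈ L(𝒜): nbc_X ∩ βnbc = ∅ if and only if X ⊆ H_1, and nbc_X ⊆ βnbc otherwise; consequently any linear order on 𝒜 in which H_1 is the first hyperplane is unmixed, and for such an order βnbc(𝒜) = {(H_{i_1}, …, H_{i_r}) ∈ nbc(𝒜) : 1 < i_1 < ⋯ < i_r ≤ n}, i.e. the standard ordered nbc-bases not containing H_1. -/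

import Mathlib

open Module

noncomputable section

/-- An arrangement of `n` (affine) hyperplanes inside the ambient affine subspace `amb`
of the complex vector space `W`.  The linear order on the hyperplanes is the order of the
indices in `Fin n`; an arbitrary linear order is encoded by a permutation `σ` of `Fin n`,
with `i ≺ j ↔ σ i < σ j`. -/
structure HArr (W : Type) [AddCommGroup W] [Module ℂ W] (n : ℕ) where
  amb : AffineSubspace ℂ W
  amb_ne : (amb : Set W).Nonempty
  H : Fin n → AffineSubspace ℂ W
  inj : Function.Injective H
  le_amb : ∀ i, H i ≤ amb
  nonemptyH : ∀ i, ((H i : Set W)).Nonempty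
  hyp : ∀ i, finrank ℂ (H i).direction + 1 = finrank ℂ amb.direction

namespace HArr

variable {W : Type} [AddCommGroup W] [Module ℂ W] {n : ℕ}

/-- The intersection `⋂ S` of a subset of the arrangement (the ambient space for `S = ∅`). -/
def inter (A : HArr W n) (S : Finset (Fin n)) : AffineSubspace ℂ W :=
  A.amb ⊓ S.inf A.H

/-- Codimension (inside the ambient space) of an affine subspace. -/
def cd (A : HArr W n) (X : AffineSubspace ℂ W) : ℕ :=
  finrank ℂ A.amb.direction - finrank ℂ X.direction

/-- A dependent subset of the arrangement. -/
def dep (A : HArr W n) (S : Finset (Fin n)) : Prop :=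
  A.inter S ≠ ⊥ ∧ A.cd (A.inter S) < S.card

/-- An independent subset of the arrangement. -/
def indep (A : HArr W n) (S : Finset (Fin n)) : Prop :=
  A.inter S ≠ ⊥ ∧ A.cd (A.inter S) = S.card

/-- A base: a maximal independent subset. -/
def isBase (A : HArr W n) (S : Finset (Fin n)) : Prop :=
  A.indep S ∧ ∀ T, A.indep T → S ⊆ T → S = T

open scoped Classical in
/-- The rank of a subarrangement `{H i : i ∈ C}`. -/
def rankOn (A : HArr W n) (C : Finset (Fin n)) : ℕ :=
  C.powerset.sup fun S => if A.indep S then S.card else 0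

/-- The rank `r` of the arrangement. -/
def rank (A : HArr W n) : ℕ := A.rankOn Finset.univ

/-- A circuit: an inclusion-minimal dependent set. -/
def circuit (A : HArr W n) (S : Finset (Fin n)) : Prop :=
  A.dep S ∧ ∀ T ⊂ S, ¬ A.dep T

/-- A broken circuit w.r.t. the linear order given by `σ`. -/
def brokenCircuit (A : HArr W n) (σ : Equiv.Perm (Fin n)) (S : Finset (Fin n)) : Prop :=
  ∃ i ∉ S, (∀ j ∈ S, σ i < σ j) ∧ A.circuit (insert i S)

/-- An nbc set: nonempty intersection and containing no broken circuit. -/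
def nbcSet (A : HArr W n) (σ : Equiv.Perm (Fin n)) (S : Finset (Fin n)) : Prop :=
  A.inter S ≠ ⊥ ∧ ∀ T ⊆ S, ¬ A.brokenCircuit σ T

/-- An nbc-base. -/
def nbcBase (A : HArr W n) (σ : Equiv.Perm (Fin n)) (S : Finset (Fin n)) : Prop :=
  A.nbcSet σ S ∧ A.isBase S

/-- A βnbc-base. -/
def betaNbcBase (A : HArr W n) (σ : Equiv.Perm (Fin n)) (S : Finset (Fin n)) : Prop :=
  A.nbcBase σ S ∧ ∀ i ∈ S, ∃ j, σ j < σ i ∧ A.isBase (insert j (S.erase i))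

/-- Membership in the intersection poset `L(𝒜)`. -/
def memL (A : HArr W n) (X : AffineSubspace ℂ W) : Prop :=
  X ≠ ⊥ ∧ ∃ S : Finset (Fin n), A.inter S = X

/-- A maximal element of `L(𝒜)` (in the reverse-inclusion order). -/
def maximalL (A : HArr W n) (X : AffineSubspace ℂ W) : Prop :=
  A.memL X ∧ ∀ Y, A.memL Y → Y ≤ X → Y = X

open scoped Classical in
/-- The set of indices of hyperplanes containing `X`, i.e. `𝒜_X`. -/
def sub (A : HArr W n) (X : AffineSubspace ℂ W) : Finset (Fin n) :=
  Finset.univ.filter fun i => X ≤ A.H i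

/-- `X` is dense: `𝒜_X` admits no decomposition into two nonempty parts. -/
def denseL (A : HArr W n) (X : AffineSubspace ℂ W) : Prop :=
  ¬ ∃ S T : Finset (Fin n), Disjoint S T ∧ S.Nonempty ∧ T.Nonempty ∧
      S ∪ T = A.sub X ∧ A.cd (A.inter S) + A.cd (A.inter T) = A.cd X

/-- `i` is the minimum of `S` w.r.t. the linear order given by `σ`. -/
def isMin (σ : Equiv.Perm (Fin n)) (i : Fin n) (S : Finset (Fin n)) : Prop :=
  i ∈ S ∧ ∀ j ∈ S, σ i ≤ σ j

/-- The standard ordered tuple of a finite set, w.r.t. the linear order given by `σ`: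
`tup σ S p` is the element of `S` with `(p+1)`-st smallest `σ`-value. -/
def tup (σ : Equiv.Perm (Fin n)) (S : Finset (Fin n)) (p : Fin S.card) : Fin n :=
  σ.symm (((S.image ⇑σ).orderIsoOfFin (Finset.card_image_of_injective S σ.injective) p).1)

/-- The flag `ξ(B) = (X_1 > ⋯ > X_r)` of a standard ordered base:
`flag σ S p = X_{p+1} = ⋂_{k ≥ p} H_{i_k}`. -/
def flag (A : HArr W n) (σ : Equiv.Perm (Fin n)) (S : Finset (Fin n)) (p : Fin S.card) :
    AffineSubspace ℂ W :=
  A.inter (S.filter fun i => σ (tup σ S p) ≤ σ i)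

/-- Lexicographic order on standard ordered tuples (for the canonical order). -/
def lexLt (S T : Finset (Fin n)) : Prop :=
  List.Lex (· < ·) (S.sort (· ≤ ·)) (T.sort (· ≤ ·))

/-- `λ(X) = Σ_{H_i ∈ 𝒜_X} λ_i`. -/
def lamX (A : HArr W n) (lam : Fin n → ℂ) (X : AffineSubspace ℂ W) : ℂ :=
  ∑ i ∈ A.sub X, lam i

/-- `X` is unmixed (w.r.t. the order `σ`). -/
def unmixedX (A : HArr W n) (σ : Equiv.Perm (Fin n)) (X : AffineSubspace ℂ W) : Prop :=
  (∀ S, A.nbcBase σ S → A.inter S = X → A.betaNbcBase σ S) ∨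
  (∀ S, A.nbcBase σ S → A.inter S = X → ¬ A.betaNbcBase σ S)

/-- The linear order given by `σ` is unmixed. -/
def unmixedOrd (A : HArr W n) (σ : Equiv.Perm (Fin n)) : Prop :=
  ∀ X, A.maximalL X → A.unmixedX σ X

/-- Membership in the intersection poset of the deleted arrangement `𝒜 ∖ {H_{i₀}}`. -/
def memLdel (A : HArr W n) (i₀ : Fin n) (X : AffineSubspace ℂ W) : Prop :=
  X ≠ ⊥ ∧ ∃ S : Finset (Fin n), i₀ ∉ S ∧ A.inter S = X

/-- A maximal element of the intersection poset of the deleted arrangement. -/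
def maximalLdel (A : HArr W n) (i₀ : Fin n) (X : AffineSubspace ℂ W) : Prop :=
  A.memLdel i₀ X ∧ ∀ Y, A.memLdel i₀ Y → Y ≤ X → Y = X

/-- The generator `e_i` of the exterior algebra `E`. -/
def gen (i : Fin n) : ExteriorAlgebra ℂ (Fin n → ℂ) :=
  ExteriorAlgebra.ι ℂ (Pi.single i 1)

/-- `e_S = e_{i_1} ∧ ⋯ ∧ e_{i_p}` for `S = {i_1 < ⋯ < i_p}`. -/
def eS (S : Finset (Fin n)) : ExteriorAlgebra ℂ (Fin n → ℂ) :=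
  ((S.sort (· ≤ ·)).map gen).prod

/-- `∂e_S = Σ_k (−1)^{k−1} e_{S ∖ {i_k}}`. -/
def bdry (S : Finset (Fin n)) : ExteriorAlgebra ℂ (Fin n → ℂ) :=
  ∑ i ∈ S, ((-1 : ℂ) ^ (S.filter fun j => j < i).card) • eS (S.erase i)

/-- The defining relations of the Orlik–Solomon algebra. -/
inductive OSRel (A : HArr W n) :
    ExteriorAlgebra ℂ (Fin n → ℂ) → ExteriorAlgebra ℂ (Fin n → ℂ) → Prop
  | isBot : ∀ S : Finset (Fin n), A.inter S = ⊥ → OSRel A (eS S) 0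
  | isDep : ∀ S : Finset (Fin n), A.dep S → OSRel A (bdry S) 0

/-- The Orlik–Solomon algebra `A(𝒜)`: the exterior algebra modulo the ideal generated by
the `e_S` with empty intersection and the `∂e_S` with `S` dependent. -/
abbrev OS (A : HArr W n) := RingQuot (OSRel A)

/-- The quotient map `E → A(𝒜)`. -/
def osMk (A : HArr W n) : ExteriorAlgebra ℂ (Fin n → ℂ) →ₐ[ℂ] OS A :=
  RingQuot.mkAlgHom ℂ (OSRel A)

/-- `ω_i`, the image of `e_i` in the Orlik–Solomon algebra. -/
def om (A : HArr W n) (i : Fin n) : OS A := osMk A (gen i)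

/-- `ω_B`, the image of `e_B` in the Orlik–Solomon algebra. -/
def omB (A : HArr W n) (S : Finset (Fin n)) : OS A := osMk A (eS S)

/-- The degree `p` part `A^p` of the Orlik–Solomon algebra. -/
def deg (A : HArr W n) (p : ℕ) : Submodule ℂ (OS A) :=
  Submodule.span ℂ {x | ∃ S : Finset (Fin n), S.card = p ∧ x = omB A S}

/-- `ω_λ = Σ_i λ_i ω_i`. -/
def omLam (A : HArr W n) (lam : Fin n → ℂ) : OS A := ∑ i, lam i • om A i

/-- `ω_λ(X) = Σ_{H_i ∈ 𝒜_X} λ_i ω_i`. -/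
def omLamX (A : HArr W n) (lam : Fin n → ℂ) (X : AffineSubspace ℂ W) : OS A :=
  ∑ i ∈ A.sub X, lam i • om A i

/-- The form `Ξ(B) = ω_λ(X_1) ⋯ ω_λ(X_r)` attached to a standard ordered base. -/
def Xi (A : HArr W n) (σ : Equiv.Perm (Fin n)) (lam : Fin n → ℂ) (S : Finset (Fin n)) :
    OS A :=
  ((List.finRange S.card).map fun p => A.omLamX lam (A.flag σ S p)).prod

/-- The submodule `ω_λ ∧ A^p` of the Orlik-Solomon algebra. -/
def Ideg (A : HArr W n) (lam : Fin n → ℂ) (p : ℕ) : Submodule ℂ (OS A) :=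
  (A.deg p).map (LinearMap.mulLeft ℂ (A.omLam lam))

end HArr

namespace HArr

variable {W : Type} [AddCommGroup W] [Module ℂ W] {n : ℕ} (A : HArr W n)

theorem inter_empty : A.inter ∅ = A.amb := by
  simp [inter]

theorem inter_insert (i : Fin n) (S : Finset (Fin n)) :
    A.inter (insert i S) = A.H i ⊓ A.inter S := by
  simp only [inter, Finset.inf_insert]
  rw [inf_left_comm]

theorem inter_anti {S T : Finset (Fin n)} (h : S ⊆ T) : A.inter T ≤ A.inter S :=
  inf_le_inf_left _ (Finset.inf_mono h)

theorem inter_le_amb (S : Finset (Fin n)) : A.inter S ≤ A.amb :=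
  inf_le_left

theorem inter_le_H {i : Fin n} {S : Finset (Fin n)} (h : i ∈ S) : A.inter S ≤ A.H i :=
  inf_le_right.trans (Finset.inf_le h)

theorem inter_insert_of_le {i : Fin n} {S : Finset (Fin n)} (h : A.inter S ≤ A.H i) :
    A.inter (insert i S) = A.inter S := by
  rw [inter_insert, inf_eq_right.mpr h]

theorem inter_ne_bot_of_subset {S T : Finset (Fin n)} (h : S ⊆ T) (hT : A.inter T ≠ ⊥) :
    A.inter S ≠ ⊥ :=
  fun hS => hT (le_bot_iff.mp (hS ▸ A.inter_anti h))

theorem direction_le_of_inf_eq_bot [FiniteDimensional ℂ W] {X : AffineSubspace ℂ W}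
    (hX : X ≤ A.amb) (hne : X ≠ ⊥) {i : Fin n} (h : A.H i ⊓ X = ⊥) :
    X.direction ≤ (A.H i).direction := by
  by_contra hle
  obtain ⟨x, hx⟩ := (AffineSubspace.nonempty_iff_ne_bot X).mpr hne
  obtain ⟨y, hy⟩ := A.nonemptyH i
  have hlt : (A.H i).direction < (A.H i).direction ⊔ X.direction := left_lt_sup.mpr hle
  have hsup : (A.H i).direction ⊔ X.direction = A.amb.direction := by
    apply Submodule.eq_of_le_of_finrank_le
      (sup_le (AffineSubspace.direction_le (A.le_amb i)) (AffineSubspace.direction_le hX))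
    have := Submodule.finrank_lt_finrank_of_lt hlt
    have := A.hyp i
    omega
  have hxy : x -ᵥ y ∈ A.amb.direction :=
    AffineSubspace.vsub_mem_direction (hX hx) (A.le_amb i hy)
  rw [← hsup, Submodule.mem_sup] at hxy
  obtain ⟨u, hu, v, hv, huv⟩ := hxy
  have h1 : u +ᵥ y ∈ A.H i := AffineSubspace.vadd_mem_of_mem_direction hu hy
  have h2 : (-v) +ᵥ x ∈ X :=
    AffineSubspace.vadd_mem_of_mem_direction (X.direction.neg_mem hv) hx
  have h3 : (-v) +ᵥ x = u +ᵥ y := by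
    simp only [vadd_eq_add, vsub_eq_sub] at *
    rw [eq_sub_iff_add_eq] at huv
    rw [← huv]
    abel
  have h4 : u +ᵥ y ∈ A.H i ⊓ X := ⟨h1, h3 ▸ h2⟩
  rw [h] at h4
  exact AffineSubspace.notMem_bot ℂ W _ h4

theorem finrank_direction_inf [FiniteDimensional ℂ W] {X : AffineSubspace ℂ W}
    (hX : X ≤ A.amb) {i : Fin n} (hne : A.H i ⊓ X ≠ ⊥) (h : ¬ X ≤ A.H i) :
    finrank ℂ (A.H i ⊓ X).direction + 1 = finrank ℂ X.direction := by
  obtain ⟨p, hpH, hpX⟩ := (AffineSubspace.nonempty_iff_ne_bot _).mpr hne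
  have hle : ¬ X.direction ≤ (A.H i).direction := by
    intro hle
    refine h fun x hx => ?_
    have := AffineSubspace.vadd_mem_of_mem_direction
      (hle (AffineSubspace.vsub_mem_direction hx hpX)) hpH
    simpa using this
  have hlt : (A.H i).direction < (A.H i).direction ⊔ X.direction := left_lt_sup.mpr hle
  have h1 := Submodule.finrank_lt_finrank_of_lt hlt
  have h2 := Submodule.finrank_mono
    (sup_le (AffineSubspace.direction_le (A.le_amb i)) (AffineSubspace.direction_le hX))
  have h3 := Submodule.finrank_sup_add_finrank_inf_eq (A.H i).direction X.direction
  have h4 := A.hyp i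
  rw [AffineSubspace.direction_inf_of_mem hpH hpX]
  omega

theorem indep.not_dep {A : HArr W n} {S : Finset (Fin n)} (hS : A.indep S) : ¬ A.dep S :=
  fun h => h.2.ne hS.2

theorem dep.exists_circuit {A : HArr W n} {S : Finset (Fin n)} (hS : A.dep S) :
    ∃ C ⊆ S, A.circuit C := by
  obtain ⟨C, hCS, hC⟩ := exists_minimal_le_of_wellFoundedLT A.dep S hS
  exact ⟨C, hCS, hC.1, fun T hT hd => hT.2 (hC.2 hd hT.1)⟩

theorem maximalL.isBase {A : HArr W n} {X : AffineSubspace ℂ W} (hX : A.maximalL X)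
    {S : Finset (Fin n)} (hS : A.indep S) (h : A.inter S = X) : A.isBase S := by
  refine ⟨hS, fun T hT hST => Finset.eq_of_subset_of_card_le hST ?_⟩
  have := hX.2 _ ⟨hT.1, T, rfl⟩ (h ▸ A.inter_anti hST)
  rw [← hT.2, ← hS.2, this, h]

theorem circuit.one_lt_card {A : HArr W n} {C : Finset (Fin n)} (hC : A.circuit C) :
    1 < C.card := by
  by_contra hle
  rcases Nat.lt_or_ge 0 C.card with h0 | h0
  · obtain ⟨i, rfl⟩ := Finset.card_eq_one.mp (le_antisymm (not_lt.mp hle) h0)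
    have h1 := hC.1.2
    have h2 := A.hyp i
    have h3 : A.inter {i} = A.H i := by
      simpa [inter] using A.le_amb i
    rw [h3, cd, Finset.card_singleton] at h1
    omega
  · exact absurd hC.1.2 (by omega)

variable [FiniteDimensional ℂ W]

theorem finrank_direction_le {X : AffineSubspace ℂ W} (hX : X ≤ A.amb) :
    finrank ℂ X.direction ≤ finrank ℂ A.amb.direction :=
  Submodule.finrank_mono (AffineSubspace.direction_le hX)

theorem cd_inter_insert {i : Fin n} {S : Finset (Fin n)} (hne : A.inter (insert i S) ≠ ⊥)
    (h : ¬ A.inter S ≤ A.H i) : A.cd (A.inter (insert i S)) = A.cd (A.inter S) + 1 := by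
  rw [inter_insert] at hne ⊢
  have h1 := A.finrank_direction_inf (A.inter_le_amb S) hne h
  have h2 := A.finrank_direction_le (A.inter_le_amb S)
  simp only [cd]
  omega

theorem cd_inter_le_card {S : Finset (Fin n)} (hne : A.inter S ≠ ⊥) :
    A.cd (A.inter S) ≤ S.card := by
  induction S using Finset.induction_on with
  | empty =>
    rw [inter_empty]
    simp [cd]
  | insert i S hi ih =>
    have := ih (A.inter_ne_bot_of_subset (Finset.subset_insert i S) hne)
    rw [Finset.card_insert_of_notMem hi]
    by_cases h : A.inter S ≤ A.H i
    · rw [A.inter_insert_of_le h]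
      omega
    · rw [A.cd_inter_insert hne h]
      omega

theorem indep_of_irredundant {S : Finset (Fin n)} (hne : A.inter S ≠ ⊥)
    (h : ∀ i ∈ S, ¬ A.inter (S.erase i) ≤ A.H i) : A.indep S := by
  refine ⟨hne, ?_⟩
  induction S using Finset.induction_on with
  | empty =>
    rw [inter_empty]
    simp [cd]
  | insert i S hi ih =>
    rw [Finset.card_insert_of_notMem hi, A.cd_inter_insert hne,
      ih (A.inter_ne_bot_of_subset (Finset.subset_insert i S) hne)]
    · intro j hj hle
      exact h j (Finset.mem_insert_of_mem hj)
        ((A.inter_anti (Finset.erase_subset_erase j (Finset.subset_insert i S))).trans hle)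
    · simpa [Finset.erase_insert hi] using h i (Finset.mem_insert_self i S)

theorem indep.irredundant {A : HArr W n} {S : Finset (Fin n)} (hS : A.indep S) {i : Fin n}
    (hi : i ∈ S) : ¬ A.inter (S.erase i) ≤ A.H i := by
  intro hle
  have h1 := A.inter_insert_of_le hle
  rw [Finset.insert_erase hi] at h1
  have h2 := A.cd_inter_le_card (A.inter_ne_bot_of_subset (Finset.erase_subset i S) hS.1)
  have h3 := Finset.card_erase_lt_of_mem hi
  have h4 := hS.2
  rw [h1] at h4
  omega

theorem indep.subset {A : HArr W n} {S T : Finset (Fin n)} (hT : A.indep T) (h : S ⊆ T) :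
    A.indep S :=
  A.indep_of_irredundant (A.inter_ne_bot_of_subset h hT.1) fun i hi hle =>
    hT.irredundant (h hi) ((A.inter_anti (Finset.erase_subset_erase i h)).trans hle)

theorem indep_of_not_dep {S : Finset (Fin n)} (hne : A.inter S ≠ ⊥) (h : ¬ A.dep S) :
    A.indep S :=
  ⟨hne, (A.cd_inter_le_card hne).antisymm (not_lt.mp fun hlt => h ⟨hne, hlt⟩)⟩

theorem circuit.inter_erase_le {A : HArr W n} {C : Finset (Fin n)} (hC : A.circuit C)
    {i : Fin n} (hi : i ∈ C) : A.inter (C.erase i) ≤ A.H i := by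
  by_contra h
  have hind : A.indep (C.erase i) := A.indep_of_not_dep
    (A.inter_ne_bot_of_subset (Finset.erase_subset i C) hC.1.1)
    (hC.2 _ (Finset.erase_ssubset hi))
  have h1 : A.inter (insert i (C.erase i)) ≠ ⊥ := by
    rw [Finset.insert_erase hi]
    exact hC.1.1
  have h2 := A.cd_inter_insert h1 h
  rw [Finset.insert_erase hi, hind.2, Finset.card_erase_add_one hi] at h2
  exact hC.1.2.ne h2

theorem isBase.direction_le {A : HArr W n} {S : Finset (Fin n)} (hS : A.isBase S)
    (T : Finset (Fin n)) (hT : A.inter T ≠ ⊥) :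
    (A.inter S).direction ≤ (A.inter T).direction := by
  have hH : ∀ i, (A.inter S).direction ≤ (A.H i).direction := by
    intro i
    by_cases hle : A.inter S ≤ A.H i
    · exact AffineSubspace.direction_le hle
    by_cases hbot : A.H i ⊓ A.inter S = ⊥
    · exact A.direction_le_of_inf_eq_bot (A.inter_le_amb S) hS.1.1 hbot
    rw [← inter_insert] at hbot
    have hi : i ∉ S := fun hi => hle (A.inter_le_H hi)
    have hind : A.indep (insert i S) := ⟨hbot, by
      rw [A.cd_inter_insert hbot hle, hS.1.2, Finset.card_insert_of_notMem hi]⟩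
    exact absurd (hS.2 _ hind (Finset.subset_insert i S) ▸ Finset.mem_insert_self i S) hi
  induction T using Finset.induction_on with
  | empty =>
    rw [inter_empty]
    exact AffineSubspace.direction_le (A.inter_le_amb S)
  | insert i T hi ih =>
    have h1 := ih (A.inter_ne_bot_of_subset (Finset.subset_insert i T) hT)
    rw [inter_insert] at hT ⊢
    obtain ⟨p, hpH, hpT⟩ := (AffineSubspace.nonempty_iff_ne_bot _).mpr hT
    rw [AffineSubspace.direction_inf_of_mem hpH hpT]
    exact le_inf (hH i) h1

theorem isBase.card_le {A : HArr W n} {S T : Finset (Fin n)} (hS : A.isBase S)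
    (hT : A.indep T) : T.card ≤ S.card := by
  rw [← hT.2, ← hS.1.2]
  exact Nat.sub_le_sub_left (Submodule.finrank_mono (hS.direction_le T hT.1)) _

theorem isBase.of_card_eq {A : HArr W n} {S T : Finset (Fin n)} (hS : A.isBase S)
    (hT : A.indep T) (h : T.card = S.card) : A.isBase T :=
  ⟨hT, fun _ hU hTU => Finset.eq_of_subset_of_card_le hTU (h ▸ hS.card_le hU)⟩

theorem maximalL.exists_nbcBase {A : HArr W n} {X : AffineSubspace ℂ W} (hX : A.maximalL X)
    (σ : Equiv.Perm (Fin n)) : ∃ S, A.nbcBase σ S ∧ A.inter S = X := by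
  classical
  obtain ⟨S₀, hS₀⟩ := hX.1.2
  obtain ⟨S, hS, hmin⟩ := exists_minimalFor_of_wellFoundedLT
    (fun S => A.inter S = X) (fun S : Finset (Fin n) => ∑ i ∈ S, ((σ i : ℕ) + 1)) ⟨S₀, hS₀⟩
  replace hmin : ∀ T, A.inter T = X → ∑ i ∈ S, ((σ i : ℕ) + 1) ≤ ∑ i ∈ T, ((σ i : ℕ) + 1) :=
    fun T hT => (le_total _ _).elim id fun h => hmin hT h
  have hne : A.inter S ≠ ⊥ := hS ▸ hX.1.1
  have hind : A.indep S := by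
    refine A.indep_of_irredundant hne fun i hi hle => ?_
    have h1 := A.inter_insert_of_le hle
    rw [Finset.insert_erase hi, hS] at h1
    have h2 := hmin _ h1.symm
    have h3 := Finset.add_sum_erase S (fun i => (σ i : ℕ) + 1) hi
    omega
  refine ⟨S, ⟨⟨hne, ?_⟩, hX.isBase hind hS⟩, hS⟩
  rintro T hTS ⟨c, hcT, hlt, hC⟩
  have hT : T.Nonempty := by
    rw [← Finset.card_pos]
    have := hC.one_lt_card
    rw [Finset.card_insert_of_notMem hcT] at this
    omega
  obtain ⟨u, hu⟩ := hT
  have hSc : A.inter S ≤ A.H c := by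
    have := hC.inter_erase_le (Finset.mem_insert_self c T)
    rw [Finset.erase_insert hcT] at this
    exact (A.inter_anti hTS).trans this
  have hcS : c ∉ S := by
    intro hc
    exact (hind.subset (Finset.insert_subset hc hTS)).not_dep hC.1
  have hle : A.inter (insert c (S.erase u)) ≤ A.H u := by
    refine (A.inter_anti ?_).trans (hC.inter_erase_le (Finset.mem_insert_of_mem hu))
    rw [Finset.erase_insert_of_ne (ne_of_mem_of_not_mem hu hcT).symm]
    exact Finset.insert_subset_insert c (Finset.erase_subset_erase u hTS)
  have heq : A.inter (insert c (S.erase u)) = X := by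
    rw [← A.inter_insert_of_le hle, Finset.insert_comm, Finset.insert_erase (hTS hu),
      A.inter_insert_of_le hSc, hS]
  have h1 := hmin _ heq
  rw [Finset.sum_insert (fun h => hcS (Finset.mem_of_mem_erase h))] at h1
  have h2 := Finset.add_sum_erase S (fun i => (σ i : ℕ) + 1) (hTS hu)
  have h3 : (σ c : ℕ) < σ u := hlt u hu
  omega

theorem nbcBase.mem_of_inter_le {A : HArr W n} {σ : Equiv.Perm (Fin n)} {S : Finset (Fin n)}
    (hS : A.nbcBase σ S) {i : Fin n} (hi : ∀ j, j ≠ i → σ i < σ j) (hle : A.inter S ≤ A.H i) :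
    i ∈ S := by
  classical
  by_contra hiS
  have hdep : A.dep (insert i S) := by
    rw [dep, A.inter_insert_of_le hle, hS.2.1.2, Finset.card_insert_of_notMem hiS]
    exact ⟨hS.1.1, Nat.lt_succ_self _⟩
  obtain ⟨C, hCS, hC⟩ := hdep.exists_circuit
  have hiC : i ∈ C := by
    by_contra hiC
    exact (hS.2.1.subset ((Finset.subset_insert_iff_of_notMem hiC).mp hCS)).not_dep hC.1
  refine hS.1.2 (C.erase i) (Finset.subset_insert_iff.mp hCS)
    ⟨i, Finset.notMem_erase i C, fun j hj => hi j (Finset.ne_of_mem_erase hj), ?_⟩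
  rwa [Finset.insert_erase hiC]

theorem isBase.exchange_of_generic {A : HArr W n} {k : Fin n}
    (hgen : ∀ Y, A.memLdel k Y → ¬ A.maximalLdel k Y →
      A.H k ⊓ Y ≠ ⊥ ∧ A.cd (A.H k ⊓ Y) = A.cd Y + 1)
    {S : Finset (Fin n)} (hS : A.isBase S) (hk : k ∉ S) {i : Fin n} (hi : i ∈ S) :
    A.isBase (insert k (S.erase i)) := by
  have hki : k ∉ S.erase i := fun h => hk (Finset.mem_of_mem_erase h)
  have hind := hS.1.subset (Finset.erase_subset i S)
  have hnot : ¬ A.maximalLdel k (A.inter (S.erase i)) := by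
    intro hmax
    have heq := hmax.2 _ ⟨hS.1.1, S, hk, rfl⟩ (A.inter_anti (Finset.erase_subset i S))
    exact hS.1.irredundant hi (heq ▸ A.inter_le_H hi)
  obtain ⟨h1, h2⟩ := hgen _ ⟨hind.1, _, hki, rfl⟩ hnot
  have hcard : (insert k (S.erase i)).card = (S.erase i).card + 1 :=
    Finset.card_insert_of_notMem hki
  rw [← inter_insert] at h1 h2
  exact hS.of_card_eq ⟨h1, by rw [h2, hind.2, hcard]⟩
    (by rw [hcard, Finset.card_erase_add_one hi])

end HArr

open scoped Classical
/-- If `H_1` is generic (it meets every non-maximal `Y ∈ L(𝒜 ∖ {H_1})`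
transversely), then for each maximal `X ∈ L(𝒜)`: `nbc_X ∩ βnbc = ∅` iff `X ⊆ H_1`, and
`nbc_X ⊆ βnbc` otherwise; consequently any linear order on `𝒜` with `H_1` first is
unmixed, and for such an order the βnbc-bases are exactly the nbc-bases avoiding `H_1`. -/
theorem generic_first_hyperplane_betaNbc {W : Type} [AddCommGroup W] [Module ℂ W]
    [FiniteDimensional ℂ W] {n : ℕ} (A : HArr W n) (hn : 0 < n)
    (hgen : ∀ Y, A.memLdel ⟨0, hn⟩ Y → ¬ A.maximalLdel ⟨0, hn⟩ Y →
      A.H ⟨0, hn⟩ ⊓ Y ≠ ⊥ ∧ A.cd (A.H ⟨0, hn⟩ ⊓ Y) = A.cd Y + 1) :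
    ∀ σ : Equiv.Perm (Fin n), (∀ j : Fin n, j ≠ ⟨0, hn⟩ → σ ⟨0, hn⟩ < σ j) →
      (∀ X, A.maximalL X →
        ((∀ S, A.nbcBase σ S → A.inter S = X → ¬ A.betaNbcBase σ S) ↔
            X ≤ A.H ⟨0, hn⟩) ∧
        (¬ X ≤ A.H ⟨0, hn⟩ →
          ∀ S, A.nbcBase σ S → A.inter S = X → A.betaNbcBase σ S)) ∧
      A.unmixedOrd σ ∧
      (∀ S : Finset (Fin n), A.betaNbcBase σ S ↔
        A.nbcBase σ S ∧ ⟨0, hn⟩ ∉ S) := by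
  intro σ hσ
  have hfirst : ∀ S, A.betaNbcBase σ S → ⟨0, hn⟩ ∉ S := by
    intro S hS h0
    obtain ⟨j, hj, -⟩ := hS.2 _ h0
    by_cases hj0 : j = ⟨0, hn⟩
    · exact hj.ne (congrArg σ hj0)
    · exact (hσ j hj0).asymm hj
  have hbeta : ∀ S, A.nbcBase σ S → ⟨0, hn⟩ ∉ S → A.betaNbcBase σ S := by
    refine fun S hS h0 => ⟨hS, fun i hi => ⟨⟨0, hn⟩, hσ i ?_, ?_⟩⟩
    · rintro rfl
      exact h0 hi
    · convert hS.2.exchange_of_generic hgen h0 hi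
  have hle : ∀ X, X ≤ A.H ⟨0, hn⟩ → ∀ S, A.nbcBase σ S → A.inter S = X →
      ¬ A.betaNbcBase σ S :=
    fun X hX S hS hSX hb => hfirst S hb (hS.mem_of_inter_le hσ (hSX ▸ hX))
  have hnle : ∀ X, ¬ X ≤ A.H ⟨0, hn⟩ → ∀ S, A.nbcBase σ S → A.inter S = X →
      A.betaNbcBase σ S :=
    fun X hX S hS hSX => hbeta S hS fun h0 => hX (hSX ▸ A.inter_le_H h0)
  refine ⟨fun X hX => ⟨⟨fun h => ?_, hle X⟩, hnle X⟩, fun X _ => ?_,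
    fun S => ⟨fun h => ⟨h.1, hfirst S h⟩, fun h => hbeta S h.1 h.2⟩⟩
  · by_contra hX0
    obtain ⟨S, hS, hSX⟩ := hX.exists_nbcBase σ
    exact h S hS hSX (hnle X hX0 S hS hSX)
  · by_cases hX0 : X ≤ A.H ⟨0, hn⟩
    · exact Or.inr (hle X hX0)
    · exact Or.inl (hnle X hX0)
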